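/- Let p be a prime and let E_{ij} denote the (2p+1)×(2p+1) matrix unit over F_p. Define σ₁' = I + Σ_{i=1}^{p−1} E_{i,i+1}, σ₂' = I + E_{p,p+1}, σ₃' = I + E_{p+1,p+2}, σ₄' = I + Σ_{i=p+2}^{2p} E_{i,i+1}, all elements of U_{2p+1}(F_p). Then the subgroup of U_{2p+1}(F_p) generated by σ₁', σ₂', σ₃', σ₄' has cardinality p^{p² + 2p + 2}. (This subgroup is the group Ũ₅(F_p) of the paper; in particular for p = 2 it is all of U₅(F₂), of order 2^{10}.) -/

import Mathlib

/-- `σ₁' = I + Σ_{i=1}^{p−1} E_{i,i+1}` (one-based indexing). -/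
def sig1 (p : ℕ) : Matrix (Fin (2 * p + 1)) (Fin (2 * p + 1)) (ZMod p) :=
  Matrix.of fun i j =>
    (if i = j then 1 else 0) + if (j : ℕ) = (i : ℕ) + 1 ∧ (i : ℕ) + 1 < p then 1 else 0

/-- `σ₂' = I + E_{p,p+1}` (one-based indexing). -/
def sig2 (p : ℕ) : Matrix (Fin (2 * p + 1)) (Fin (2 * p + 1)) (ZMod p) :=
  Matrix.of fun i j =>
    (if i = j then 1 else 0) + if (i : ℕ) + 1 = p ∧ (j : ℕ) = (i : ℕ) + 1 then 1 else 0

/-- `σ₃' = I + E_{p+1,p+2}` (one-based indexing). -/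
def sig3 (p : ℕ) : Matrix (Fin (2 * p + 1)) (Fin (2 * p + 1)) (ZMod p) :=
  Matrix.of fun i j =>
    (if i = j then 1 else 0) + if (i : ℕ) = p ∧ (j : ℕ) = p + 1 then 1 else 0

/-- `σ₄' = I + Σ_{i=p+2}^{2p} E_{i,i+1}` (one-based indexing). -/
def sig4 (p : ℕ) : Matrix (Fin (2 * p + 1)) (Fin (2 * p + 1)) (ZMod p) :=
  Matrix.of fun i j =>
    (if i = j then 1 else 0) +
      if (j : ℕ) = (i : ℕ) + 1 ∧ p + 1 ≤ (i : ℕ) ∧ (i : ℕ) + 1 ≤ 2 * p then 1 else 0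

namespace S11

open Matrix

/-- Index map. -/
def em (p : ℕ) : Fin p ⊕ (Unit ⊕ Fin p) → Fin (2 * p + 1)
  | Sum.inl i => ⟨i, by omega⟩
  | Sum.inr (Sum.inl _) => ⟨p, by omega⟩
  | Sum.inr (Sum.inr i) => ⟨p + 1 + i, by omega⟩

theorem em_bij (p : ℕ) : Function.Bijective (em p) := by
  rw [Fintype.bijective_iff_injective_and_card]
  constructor
  · rintro (i | i | i) (j | j | j) h <;> simp [em, Fin.ext_iff] at h ⊢ <;> omega
  · simp; omega

noncomputable def ee (p : ℕ) : Fin p ⊕ (Unit ⊕ Fin p) ≃ Fin (2 * p + 1) :=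
  Equiv.ofBijective (em p) (em_bij p)

/-- Block matrix. -/
def bl {p : ℕ} (A : Matrix (Fin p) (Fin p) (ZMod p)) (v : Fin p → ZMod p)
    (M : Matrix (Fin p) (Fin p) (ZMod p)) (w : Fin p → ZMod p)
    (B : Matrix (Fin p) (Fin p) (ZMod p)) :
    Matrix (Fin p ⊕ (Unit ⊕ Fin p)) (Fin p ⊕ (Unit ⊕ Fin p)) (ZMod p) :=
  Matrix.of fun i j => match i, j with
  | Sum.inl i, Sum.inl j => A i j
  | Sum.inl i, Sum.inr (Sum.inl _) => v i
  | Sum.inl i, Sum.inr (Sum.inr j) => M i j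
  | Sum.inr (Sum.inl _), Sum.inl _ => 0
  | Sum.inr (Sum.inl _), Sum.inr (Sum.inl _) => 1
  | Sum.inr (Sum.inl _), Sum.inr (Sum.inr j) => w j
  | Sum.inr (Sum.inr _), Sum.inl _ => 0
  | Sum.inr (Sum.inr _), Sum.inr (Sum.inl _) => 0
  | Sum.inr (Sum.inr i), Sum.inr (Sum.inr j) => B i j

theorem bl_mul {p : ℕ} (A : Matrix (Fin p) (Fin p) (ZMod p)) (v M w B A' v' M' w' B') :
    bl A v M w B * bl A' v' M' w' B' =
      bl (A * A') (A *ᵥ v' + v) (A * M' + vecMulVec v w' + M * B') (w' + w ᵥ* B') (B * B') := by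
  ext (i | i | i) (j | j | j) <;>
    simp [bl, Matrix.mul_apply, Fintype.sum_sum_type, Matrix.mulVec, Matrix.vecMul, dotProduct,
      vecMulVec_apply, add_assoc]

noncomputable def ff {p : ℕ} (A : Matrix (Fin p) (Fin p) (ZMod p)) (v : Fin p → ZMod p)
    (M : Matrix (Fin p) (Fin p) (ZMod p)) (w : Fin p → ZMod p)
    (B : Matrix (Fin p) (Fin p) (ZMod p)) :
    Matrix (Fin (2 * p + 1)) (Fin (2 * p + 1)) (ZMod p) :=
  (bl A v M w B).submatrix (ee p).symm (ee p).symm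

theorem ff_mul {p : ℕ} (A : Matrix (Fin p) (Fin p) (ZMod p)) (v M w B A' v' M' w' B') :
    ff A v M w B * ff A' v' M' w' B' =
      ff (A * A') (A *ᵥ v' + v) (A * M' + vecMulVec v w' + M * B') (w' + w ᵥ* B') (B * B') := by
  unfold ff
  rw [Matrix.submatrix_mul_equiv, bl_mul]

theorem bl_inj {p : ℕ} {A : Matrix (Fin p) (Fin p) (ZMod p)} {v M w B A' v' M' w' B'}
    (h : bl A v M w B = bl A' v' M' w' B') : A = A' ∧ v = v' ∧ M = M' ∧ w = w' ∧ B = B' := by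
  have h' := fun i j => congrFun (congrFun h i) j
  refine ⟨?_, ?_, ?_, ?_, ?_⟩
  · ext i j; exact h' (Sum.inl i) (Sum.inl j)
  · ext i; exact h' (Sum.inl i) (Sum.inr (Sum.inl ()))
  · ext i j; exact h' (Sum.inl i) (Sum.inr (Sum.inr j))
  · ext j; exact h' (Sum.inr (Sum.inl ())) (Sum.inr (Sum.inr j))
  · ext i j; exact h' (Sum.inr (Sum.inr i)) (Sum.inr (Sum.inr j))

theorem eq_ff {p : ℕ} {X : Matrix (Fin (2 * p + 1)) (Fin (2 * p + 1)) (ZMod p)}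
    {A : Matrix (Fin p) (Fin p) (ZMod p)} {v M w B}
    (h : ∀ i j, X (em p i) (em p j) = bl A v M w B i j) : X = ff A v M w B := by
  ext i j
  obtain ⟨i, rfl⟩ := (ee p).surjective i
  obtain ⟨j, rfl⟩ := (ee p).surjective j
  simp only [ff, Matrix.submatrix_apply, Equiv.symm_apply_apply]
  exact h i j

theorem ff_inj {p : ℕ} {A : Matrix (Fin p) (Fin p) (ZMod p)} {v M w B A' v' M' w' B'}
    (h : ff A v M w B = ff A' v' M' w' B') : A = A' ∧ v = v' ∧ M = M' ∧ w = w' ∧ B = B' := by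
  apply bl_inj
  ext i j
  have := congrFun (congrFun h (ee p i)) (ee p j)
  simpa [ff] using this

/-- Shift. -/
def NN (p : ℕ) : Matrix (Fin p) (Fin p) (ZMod p) :=
  Matrix.of fun i j => if (j : ℕ) = i + 1 then 1 else 0

def JJ (p : ℕ) : Matrix (Fin p) (Fin p) (ZMod p) := 1 + NN p

theorem one_ff (p : ℕ) : (1 : Matrix (Fin (2 * p + 1)) (Fin (2 * p + 1)) (ZMod p)) =
    ff 1 0 0 0 1 := by
  apply eq_ff
  rintro (i | i | i) (j | j | j) <;> simp [bl, em, Matrix.one_apply, Fin.ext_iff] <;> omega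

theorem sig1_ff (p : ℕ) : sig1 p = ff (JJ p) 0 0 0 1 := by
  apply eq_ff
  rintro (i | i | i) (j | j | j) <;>
    simp [bl, em, sig1, JJ, NN, Matrix.one_apply, Fin.ext_iff] <;> grind

theorem sig4_ff (p : ℕ) : sig4 p = ff 1 0 0 0 (JJ p) := by
  apply eq_ff
  rintro (i | i | i) (j | j | j) <;>
    simp [bl, em, sig4, JJ, NN, Matrix.one_apply, Fin.ext_iff] <;> grind

theorem sig2_ff (p : ℕ) (hp : 0 < p) :
    sig2 p = ff 1 (Pi.single ⟨p - 1, by omega⟩ 1) 0 0 1 := by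
  apply eq_ff
  rintro (i | i | i) (j | j | j) <;>
    simp [bl, em, sig2, Matrix.one_apply, Fin.ext_iff, Pi.single_apply] <;> grind

theorem sig3_ff (p : ℕ) (hp : 0 < p) :
    sig3 p = ff 1 0 0 (Pi.single ⟨0, hp⟩ 1) 1 := by
  apply eq_ff
  rintro (i | i | i) (j | j | j) <;>
    simp [bl, em, sig3, Matrix.one_apply, Fin.ext_iff, Pi.single_apply] <;> grind

theorem NN_pow (p k : ℕ) (i j : Fin p) :
    (NN p ^ k) i j = if (j : ℕ) = i + k then 1 else 0 := by
  induction k generalizing i j with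
  | zero => simp [Matrix.one_apply, Fin.ext_iff, eq_comm]
  | succ k ih =>
    rw [pow_succ', Matrix.mul_apply]
    have hN : ∀ a b, NN p a b = if (b : ℕ) = a + 1 then 1 else 0 := fun _ _ => rfl
    simp only [ih, hN, ite_mul, one_mul, zero_mul]
    by_cases h : (i : ℕ) + 1 < p
    · rw [Finset.sum_eq_single ⟨i + 1, h⟩]
      · simp; grind
      · intro b _ hb
        rw [if_neg]; intro h'; exact hb (Fin.ext h')
      · simp
    · rw [Finset.sum_eq_zero, if_neg]
      · omega
      · intro b _; rw [if_neg]; omega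

theorem JJ_pow (p : ℕ) [Fact p.Prime] : JJ p ^ p = 1 := by
  have hp := (Fact.out : p.Prime).pos
  have : Nonempty (Fin p) := ⟨⟨0, hp⟩⟩
  unfold JJ
  rw [add_pow_char_of_commute p (Commute.one_left _), one_pow]
  convert add_zero _
  ext i j
  rw [NN_pow, if_neg (by omega)]; rfl

theorem JJ_ne (p : ℕ) [Fact p.Prime] : JJ p ≠ 1 := by
  have hp := (Fact.out : p.Prime).two_le
  intro h
  have := congrFun (congrFun h ⟨0, by omega⟩) ⟨1, by omega⟩
  simp [JJ, NN, Matrix.one_apply] at this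

theorem order_JJ (p : ℕ) [Fact p.Prime] : orderOf (JJ p) = p :=
  orderOf_eq_prime (JJ_pow p) (JJ_ne p)

theorem mulVec_single' (p : ℕ) (j : ℕ) (h : j + 1 < p) :
    JJ p *ᵥ (Pi.single ⟨j + 1, h⟩ 1) =
      Pi.single ⟨j + 1, h⟩ 1 + Pi.single ⟨j, by omega⟩ 1 := by
  ext i
  simp [JJ, NN, Matrix.one_apply, Pi.single_apply, Fin.ext_iff]
  grind

theorem vecMul_single' (p : ℕ) (j : ℕ) (h : j + 1 < p) :
    (Pi.single ⟨j, by omega⟩ 1) ᵥ* JJ p =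
      Pi.single ⟨j, by omega⟩ 1 + Pi.single ⟨j + 1, h⟩ 1 := by
  ext i
  simp [JJ, NN, Matrix.one_apply, Pi.single_apply, Fin.ext_iff]
  grind

/-- An additive submonoid of vectors containing all basis vectors is everything. -/
theorem top_of_single {p : ℕ} [Fact p.Prime] (V : AddSubmonoid (Fin p → ZMod p))
    (h : ∀ j, Pi.single j 1 ∈ V) (v : Fin p → ZMod p) : v ∈ V := by
  rw [← Finset.univ_sum_single v]
  refine sum_mem fun i _ => ?_
  have : Pi.single i (v i) = (v i).val • (Pi.single i 1 : Fin p → ZMod p) := by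
    rw [← Pi.single_smul]
    simp
  rw [this]
  exact nsmul_mem (h i) _

theorem cancel_mem {p : ℕ} [Fact p.Prime] (V : AddSubmonoid (Fin p → ZMod p))
    {x y : Fin p → ZMod p} (hx : x ∈ V) (h : x + y ∈ V) : y ∈ V := by
  have : y = (x + y) + (p - 1) • x := by
    have h1 : p • x = 0 := by ext i; simp
    have h2 : x + (p - 1) • x = 0 := by
      rw [← h1, ← succ_nsmul']
      congr 1
      have := (Fact.out : p.Prime).pos
      omega
    calc y = y + (x + (p - 1) • x) := by rw [h2, add_zero]
      _ = _ := by abel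
  rw [this]
  exact add_mem h (nsmul_mem hx _)

section gen

variable {p : ℕ} [Fact p.Prime]
  (K : Submonoid (Matrix (Fin (2 * p + 1)) (Fin (2 * p + 1)) (ZMod p)))

theorem pow_left (n : ℕ) : (ff (JJ p) 0 0 0 1) ^ n = ff (JJ p ^ n) 0 0 0 1 := by
  induction n with
  | zero => simp [one_ff]
  | succ n ih => rw [pow_succ, ih, ff_mul]; simp [pow_succ]

theorem pow_right (n : ℕ) : (ff 1 0 0 0 (JJ p)) ^ n = ff 1 0 0 0 (JJ p ^ n) := by
  induction n with
  | zero => simp [one_ff]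
  | succ n ih => rw [pow_succ, ih, ff_mul]; simp [pow_succ]

theorem JJ_inv : JJ p * JJ p ^ (p - 1) = 1 := by
  rw [← pow_succ', Nat.sub_add_cancel (Fact.out : p.Prime).one_le, JJ_pow]

theorem JJ_inv' : JJ p ^ (p - 1) * JJ p = 1 := by
  rw [← pow_succ, Nat.sub_add_cancel (Fact.out : p.Prime).one_le, JJ_pow]

theorem vmem (h1 : sig1 p ∈ K) (h2 : sig2 p ∈ K) (v) : ff 1 v 0 0 1 ∈ K := by
  have hp := (Fact.out : p.Prime).pos
  let V : AddSubmonoid (Fin p → ZMod p) :=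
    { carrier := {v | ff 1 v 0 0 1 ∈ K}
      zero_mem' := by
        change ff 1 0 0 0 1 ∈ K
        rw [← one_ff]; exact one_mem K
      add_mem' := by
        intro a b ha hb
        have := K.mul_mem hb ha
        rw [ff_mul] at this
        simpa using this }
  have hJ : ∀ v ∈ V, JJ p *ᵥ v ∈ V := by
    intro v hv
    rw [sig1_ff] at h1
    have := mul_mem (mul_mem h1 hv) (pow_mem h1 (p - 1))
    rw [pow_left, ff_mul, ff_mul] at this
    change ff 1 _ 0 0 1 ∈ K
    simpa [JJ_inv] using this
  refine top_of_single V ?_ v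
  have key : ∀ k, ∀ h : k < p, Pi.single ⟨p - 1 - k, by omega⟩ 1 ∈ V := by
    intro k
    induction k with
    | zero =>
      intro h
      rw [sig2_ff p hp] at h2
      exact h2
    | succ k ih =>
      intro h
      have h3 := ih (by omega)
      have h4 := hJ _ h3
      have e : (⟨p - 1 - k, by omega⟩ : Fin p) = ⟨(p - 1 - (k + 1)) + 1, by omega⟩ := by
        ext; simp; omega
      rw [e] at h3 h4
      rw [mulVec_single'] at h4
      exact cancel_mem V h3 h4
  intro j
  have := key (p - 1 - j) (by omega)
  convert this
  omega

theorem wmem (h3 : sig3 p ∈ K) (h4 : sig4 p ∈ K) (w) : ff 1 0 0 w 1 ∈ K := by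
  have hp := (Fact.out : p.Prime).pos
  let V : AddSubmonoid (Fin p → ZMod p) :=
    { carrier := {v | ff 1 0 0 v 1 ∈ K}
      zero_mem' := by
        change ff 1 0 0 0 1 ∈ K
        rw [← one_ff]; exact one_mem K
      add_mem' := by
        intro a b ha hb
        have := K.mul_mem hb ha
        rw [ff_mul] at this
        simpa using this }
  have hJ : ∀ v ∈ V, v ᵥ* JJ p ∈ V := by
    intro v hv
    rw [sig4_ff] at h4
    have := mul_mem (pow_mem h4 (p - 1)) (mul_mem hv h4)
    rw [pow_right, ff_mul, ff_mul] at this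
    change ff 1 0 0 _ 1 ∈ K
    simpa [JJ_inv'] using this
  refine top_of_single V ?_ w
  have key : ∀ k, ∀ h : k < p, Pi.single ⟨k, h⟩ 1 ∈ V := by
    intro k
    induction k with
    | zero =>
      intro h
      rw [sig3_ff p hp] at h3
      exact h3
    | succ k ih =>
      intro h
      have h5 := ih (by omega)
      have h6 := hJ _ h5
      rw [vecMul_single' p k h] at h6
      exact cancel_mem V h5 h6
  intro j
  exact key j j.2

theorem Mmem (hv : ∀ v, ff 1 v 0 0 1 ∈ K) (hw : ∀ w, ff 1 0 0 w 1 ∈ K) (M) :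
    ff 1 0 M 0 1 ∈ K := by
  let V : AddSubmonoid (Matrix (Fin p) (Fin p) (ZMod p)) :=
    { carrier := {M | ff 1 0 M 0 1 ∈ K}
      zero_mem' := by
        change ff 1 0 0 0 1 ∈ K
        rw [← one_ff]; exact one_mem K
      add_mem' := by
        intro a b ha hb
        have := K.mul_mem hb ha
        rw [ff_mul] at this
        simpa using this }
  have h1 : ∀ v w, vecMulVec v w ∈ V := by
    intro v w
    have := mul_mem (mul_mem (hv v) (hw w)) (mul_mem (hv (-v)) (hw (-w)))
    simp only [ff_mul] at this
    change ff 1 0 _ 0 1 ∈ K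
    simpa [Matrix.neg_vecMulVec, Matrix.vecMulVec_neg] using this
  have : M = ∑ i, vecMulVec (Pi.single i 1) (M i) := by
    ext a b
    simp [Matrix.sum_apply, vecMulVec_apply, Pi.single_apply]
  change M ∈ V
  rw [this]
  exact sum_mem fun i _ => h1 _ _

theorem allmem (h1 : sig1 p ∈ K) (h2 : sig2 p ∈ K) (h3 : sig3 p ∈ K) (h4 : sig4 p ∈ K)
    {A B} (hA : A ∈ Submonoid.powers (JJ p)) (hB : B ∈ Submonoid.powers (JJ p)) (v M w) :
    ff A v M w B ∈ K := by
  have hv := vmem K h1 h2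
  have hw := wmem K h3 h4
  have hM := Mmem K hv hw
  obtain ⟨a, rfl⟩ := hA
  obtain ⟨b, rfl⟩ := hB
  rw [sig1_ff] at h1
  rw [sig4_ff] at h4
  have h1 := pow_mem h1 a
  have h4 := pow_mem h4 b
  rw [pow_left] at h1
  rw [pow_right] at h4
  have := mul_mem h4 (mul_mem (hv v) (mul_mem (hM (M - vecMulVec v w)) (mul_mem h1 (hw w))))
  simp only [ff_mul] at this
  simpa using this

end gen

end S11

/-- For a prime `p`, the subgroup of `U_{2p+1}(F_p)` generated by `σ₁', σ₂', σ₃', σ₄'`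
(this is the group `Ũ₅(F_p)` of the paper) has cardinality `p^{p² + 2p + 2}`. -/
theorem stmt_11 (p : ℕ) (hp : p.Prime) :
    Nat.card (Subgroup.closure
        {u : (Matrix (Fin (2 * p + 1)) (Fin (2 * p + 1)) (ZMod p))ˣ |
          (u : Matrix (Fin (2 * p + 1)) (Fin (2 * p + 1)) (ZMod p)) = sig1 p ∨
          (u : Matrix (Fin (2 * p + 1)) (Fin (2 * p + 1)) (ZMod p)) = sig2 p ∨
          (u : Matrix (Fin (2 * p + 1)) (Fin (2 * p + 1)) (ZMod p)) = sig3 p ∨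
          (u : Matrix (Fin (2 * p + 1)) (Fin (2 * p + 1)) (ZMod p)) = sig4 p}) =
      p ^ (p ^ 2 + 2 * p + 2) := by
  have : Fact p.Prime := ⟨hp⟩
  have hp0 := hp.pos
  set S := {u : (Matrix (Fin (2 * p + 1)) (Fin (2 * p + 1)) (ZMod p))ˣ |
          (u : Matrix (Fin (2 * p + 1)) (Fin (2 * p + 1)) (ZMod p)) = sig1 p ∨
          (u : Matrix (Fin (2 * p + 1)) (Fin (2 * p + 1)) (ZMod p)) = sig2 p ∨
          (u : Matrix (Fin (2 * p + 1)) (Fin (2 * p + 1)) (ZMod p)) = sig3 p ∨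
          (u : Matrix (Fin (2 * p + 1)) (Fin (2 * p + 1)) (ZMod p)) = sig4 p} with hS
  let F : Submonoid.powers (S11.JJ p) × Submonoid.powers (S11.JJ p) × (Fin p → ZMod p) ×
      (Fin p → ZMod p) × Matrix (Fin p) (Fin p) (ZMod p) →
      Matrix (Fin (2 * p + 1)) (Fin (2 * p + 1)) (ZMod p) :=
    fun t => S11.ff t.1.1 t.2.2.1 t.2.2.2.2 t.2.2.2.1 t.2.1.1
  have hF : Function.Injective F := by
    rintro ⟨A, B, v, w, M⟩ ⟨A', B', v', w', M'⟩ h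
    obtain ⟨h1, h2, h3, h4, h5⟩ := S11.ff_inj h
    simp only [Prod.mk.injEq]
    exact ⟨Subtype.ext h1, Subtype.ext h5, h2, h4, h3⟩
  let T : Submonoid (Matrix (Fin (2 * p + 1)) (Fin (2 * p + 1)) (ZMod p)) :=
    { carrier := Set.range F
      one_mem' := ⟨(1, 1, 0, 0, 0), (S11.one_ff p).symm⟩
      mul_mem' := by
        rintro _ _ ⟨⟨A, B, v, w, M⟩, rfl⟩ ⟨⟨A', B', v', w', M'⟩, rfl⟩
        refine ⟨(A * A', B * B', _, _, _), (S11.ff_mul _ _ _ _ _ _ _ _ _ _).symm⟩ }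
  have hJ : S11.JJ p ∈ Submonoid.powers (S11.JJ p) := Submonoid.mem_powers _
  have hST : ∀ u ∈ S, (u : Matrix (Fin (2 * p + 1)) (Fin (2 * p + 1)) (ZMod p)) ∈ T := by
    rintro u (h | h | h | h) <;> rw [h]
    · exact ⟨(⟨_, hJ⟩, 1, 0, 0, 0), (S11.sig1_ff p).symm⟩
    · exact ⟨(1, 1, _, 0, 0), (S11.sig2_ff p hp0).symm⟩
    · exact ⟨(1, 1, 0, _, 0), (S11.sig3_ff p hp0).symm⟩
    · exact ⟨(1, ⟨_, hJ⟩, 0, 0, 0), (S11.sig4_ff p).symm⟩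
  have hup : ∀ u ∈ Subgroup.closure S,
      (u : Matrix (Fin (2 * p + 1)) (Fin (2 * p + 1)) (ZMod p)) ∈ T := by
    intro u hu
    induction hu using Subgroup.closure_induction with
    | mem x hx => exact hST x hx
    | one => exact one_mem T
    | mul x y _ _ hx hy => rw [Units.val_mul]; exact mul_mem hx hy
    | inv x _ hx =>
      have : x⁻¹ = x ^ (orderOf x - 1) := by
        rw [inv_eq_iff_mul_eq_one, ← pow_succ', Nat.sub_add_cancel (orderOf_pos x),
          pow_orderOf_eq_one]
      rw [this, Units.val_pow_eq_pow_val]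
      exact pow_mem hx _
  let K := (Subgroup.closure S).toSubmonoid.map
    (Units.coeHom (Matrix (Fin (2 * p + 1)) (Fin (2 * p + 1)) (ZMod p)))
  have inK : ∀ X Y : Matrix (Fin (2 * p + 1)) (Fin (2 * p + 1)) (ZMod p), X * Y = 1 →
      (X = sig1 p ∨ X = sig2 p ∨ X = sig3 p ∨ X = sig4 p) → X ∈ K := by
    intro X Y h hX
    exact ⟨⟨X, Y, h, mul_eq_one_comm.mp h⟩, Subgroup.subset_closure hX, rfl⟩
  have k1 : sig1 p ∈ K := by
    refine inK _ (S11.ff (S11.JJ p ^ (p - 1)) 0 0 0 1) ?_ (by simp)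
    rw [S11.sig1_ff, S11.ff_mul, S11.one_ff]; simp [S11.JJ_inv]
  have k2 : sig2 p ∈ K := by
    refine inK _ (S11.ff 1 (-Pi.single ⟨p - 1, by omega⟩ 1) 0 0 1) ?_ (by simp)
    rw [S11.sig2_ff p hp0, S11.ff_mul, S11.one_ff]; simp
  have k3 : sig3 p ∈ K := by
    refine inK _ (S11.ff 1 0 0 (-Pi.single ⟨0, hp0⟩ 1) 1) ?_ (by simp)
    rw [S11.sig3_ff p hp0, S11.ff_mul, S11.one_ff]; simp
  have k4 : sig4 p ∈ K := by
    refine inK _ (S11.ff 1 0 0 0 (S11.JJ p ^ (p - 1))) ?_ (by simp)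
    rw [S11.sig4_ff, S11.ff_mul, S11.one_ff]; simp [S11.JJ_inv]
  have hset : (Units.val '' (Subgroup.closure S : Set _)) = Set.range F := by
    apply Set.Subset.antisymm
    · rintro _ ⟨u, hu, rfl⟩
      exact hup u hu
    · rintro _ ⟨⟨A, B, v, w, M⟩, rfl⟩
      exact S11.allmem K k1 k2 k3 k4 A.2 B.2 v M w
  have e1 : Nat.card (Subgroup.closure S) = Nat.card (Set.range F) := by
    rw [← hset]
    exact (Nat.card_image_of_injective Units.val_injective _).symm
  rw [e1, Nat.card_range_of_injective hF]
  have hc : Nat.card (Submonoid.powers (S11.JJ p)) = p := by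
    have hu : orderOf (Units.mk (S11.JJ p) _ S11.JJ_inv S11.JJ_inv') = p := by
      rw [← orderOf_units]; exact S11.order_JJ p
    have h1 := Nat.card_submonoidPowers (a := Units.mk (S11.JJ p) _ S11.JJ_inv S11.JJ_inv')
    rw [hu] at h1
    have h2 : Submonoid.powers (S11.JJ p) = (Submonoid.powers
        (Units.mk (S11.JJ p) _ S11.JJ_inv S11.JJ_inv')).map (Units.coeHom _) := by
      rw [Submonoid.map_powers]; rfl
    rw [h2]
    exact (Nat.card_image_of_injective Units.val_injective _).trans h1
  simp only [Nat.card_prod]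
  rw [hc]
  simp only [ Matrix, Nat.card_fun,
    Nat.card_zmod, Nat.card_fin]
  ring
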